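/- arXiv:1608.00926 — 5 statements merged into one kernel-verified Lean document; each statement's English description precedes it below -/
import Mathlib

section
/- If S is a depiction of R and q ∈ Z_{S/R}, then the geometric height of q ∩ R in R equals the height of q in S, i.e. ght(q ∩ R) = ht_S(q). -/
/-! Common framework: depictions of nonnoetherian integral domains (Beil).
`K` plays the role of the fraction field `Frac R`; all rings are `k`-subalgebras of `K`. -/

section Depictions

variable {k K : Type*} [Field k] [Field K] [Algebra k K]

/-- The localization `A_p` of a subalgebra `A ⊆ K` at a prime ideal `p`,
viewed as a subalgebra of `K`. -/
def locAt (A : Subalgebra k K) (p : Ideal A) (hp : p.IsPrime) : Subalgebra k K where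
  carrier := {x : K | ∃ a s : A, s ∉ p ∧ x * (s : K) = (a : K)}
  one_mem' := ⟨1, 1, (Ideal.ne_top_iff_one p).mp hp.ne_top, by simp⟩
  zero_mem' := ⟨0, 1, (Ideal.ne_top_iff_one p).mp hp.ne_top, by simp⟩
  mul_mem' := by
    rintro x y ⟨a, s, hs, hx⟩ ⟨b, t, ht, hy⟩
    refine ⟨a * b, s * t, fun h => ((hp.mem_or_mem h).elim hs ht), ?_⟩
    have : x * y * ((s : K) * (t : K)) = (x * s) * (y * t) := by ring
    push_cast
    rw [this, hx, hy]
  add_mem' := by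
    rintro x y ⟨a, s, hs, hx⟩ ⟨b, t, ht, hy⟩
    refine ⟨a * t + b * s, s * t, fun h => ((hp.mem_or_mem h).elim hs ht), ?_⟩
    have : (x + y) * ((s : K) * (t : K)) = (x * s) * t + (y * t) * s := by ring
    push_cast
    rw [this, hx, hy]
  algebraMap_mem' := fun c =>
    ⟨algebraMap k A c, 1, (Ideal.ne_top_iff_one p).mp hp.ne_top, by simp⟩

lemma mem_locAt {A : Subalgebra k K} {p : Ideal A} {hp : p.IsPrime} {x : K} :
    x ∈ locAt A p hp ↔ ∃ a s : A, s ∉ p ∧ x * (s : K) = (a : K) := Iff.rfl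

/-- `n ∈ U_{S/R}`: `n` is a maximal ideal of `S` with `R_{n ∩ R} = S_n`. -/
def memU (R S : Subalgebra k K) (h : R ≤ S) (n : Ideal S) : Prop :=
  ∃ hn : n.IsMaximal,
    locAt R (n.comap (Subalgebra.inclusion h)) (hn.isPrime.comap _) = locAt S n hn.isPrime

/-- `q ∈ Z_{S/R}`: `q` is a prime of `S` whose zero locus meets `U_{S/R}`,
i.e. some `n ∈ U_{S/R}` contains `q`. -/
def memZ (R S : Subalgebra k K) (h : R ≤ S) (q : Ideal S) : Prop :=
  q.IsPrime ∧ ∃ n : Ideal S, memU R S h n ∧ q ≤ n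

/-- `S` is a depiction of `R`. -/
structure IsDepiction (R S : Subalgebra k K) : Prop where
  le : R ≤ S
  fg : S.FG
  specSurj : ∀ p : Ideal R, p.IsPrime →
    ∃ q : Ideal S, q.IsPrime ∧ q.comap (Subalgebra.inclusion le) = p
  memU_iff : ∀ (n : Ideal S) (hn : n.IsMaximal),
    memU R S le n ↔
      IsNoetherianRing (locAt R (n.comap (Subalgebra.inclusion le)) (hn.isPrime.comap _))
  nonempty : ∃ n : Ideal S, memU R S le n

/-- The height of an ideal `q`, as the Krull dimension of the set of primes contained in `q`. -/
noncomputable def htOf {A : Type*} [CommRing A] (q : Ideal A) : WithBot ℕ∞ :=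
  Order.krullDim {p : PrimeSpectrum A // p.asIdeal ≤ q}

/-- The geometric height of a prime `p` of `R`: the minimum of the heights `ht_S q` over all
depictions `S` of `R` and primes `q` of `S` with `q ∩ R = p`. -/
noncomputable def ght (R : Subalgebra k K) (p : Ideal R) : WithBot ℕ∞ :=
  sInf {h | ∃ (S : Subalgebra k K) (hd : IsDepiction R S) (q : Ideal S),
    q.IsPrime ∧ q.comap (Subalgebra.inclusion hd.le) = p ∧ h = htOf q}

/-- The geometric dimension of a prime `p` of `R`: `gdim p = dim R - ght p`. -/
noncomputable def gdim (R : Subalgebra k K) (p : Ideal R) : WithBot ℕ∞ :=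
  Option.map₂ (· - ·) (ringKrullDim ↥R) (ght R p)

/-- `T := ⋂_{n ∈ U_{S/R}} S_n`, as a subalgebra of `K`. -/
noncomputable def depT (R S : Subalgebra k K) (h : R ≤ S) : Subalgebra k K :=
  sInf {L | ∃ (n : Ideal S) (hn : n.IsMaximal), memU R S h n ∧ L = locAt S n hn.isPrime}

lemma le_depT (R S : Subalgebra k K) (h : R ≤ S) : S ≤ depT R S h := by
  refine le_sInf ?_
  rintro L ⟨n, hn, -, rfl⟩
  intro x hx
  exact ⟨⟨x, hx⟩, 1, (Ideal.ne_top_iff_one n).mp hn.ne_top, by simp⟩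

/-- A depiction `S` of `R` witnesses `noetherian in codimension 1`:
every height 1 prime of `S` lies in `Z_{S/R}`. -/
def Witnessing (R S : Subalgebra k K) (h : R ≤ S) : Prop :=
  ∀ q : Ideal S, q.IsPrime → htOf q = 1 → memZ R S h q

/-- `R` is noetherian in codimension 1. -/
def NoethCodimOne (R : Subalgebra k K) : Prop :=
  ∃ (S : Subalgebra k K) (hd : IsDepiction R S), Witnessing R S hd.le

/-- A depiction `S` of `R` is saturated if `ght (q ∩ R) = ht_S q` for every prime `q` of `S`
minimal over `(q ∩ R)S`. -/
def IsSaturated (R S : Subalgebra k K) (h : R ≤ S) : Prop :=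
  ∀ q : Ideal S,
    q ∈ (Ideal.map (Subalgebra.inclusion h) (q.comap (Subalgebra.inclusion h))).minimalPrimes →
      ght R (q.comap (Subalgebra.inclusion h)) = htOf q

/-- The subalgebra `k + p ⊆ K`, for `p` an ideal of a subalgebra `S ⊆ K`. -/
def kPlus (S : Subalgebra k K) (p : Ideal S) : Subalgebra k K where
  carrier := {x : K | ∃ (c : k) (f : S), f ∈ p ∧ x = algebraMap k K c + (f : K)}
  one_mem' := ⟨1, 0, p.zero_mem, by simp⟩
  zero_mem' := ⟨0, 0, p.zero_mem, by simp⟩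
  mul_mem' := by
    rintro x y ⟨c, f, hf, rfl⟩ ⟨d, g, hg, rfl⟩
    refine ⟨c * d, algebraMap k S c * g + algebraMap k S d * f + f * g,
      add_mem (add_mem (p.mul_mem_left _ hg) (p.mul_mem_left _ hf)) (p.mul_mem_left _ hg),
      ?_⟩
    push_cast
    ring
  add_mem' := by
    rintro x y ⟨c, f, hf, rfl⟩ ⟨d, g, hg, rfl⟩
    exact ⟨c + d, f + g, add_mem hf hg, by push_cast; ring⟩
  algebraMap_mem' := fun c => ⟨c, 0, p.zero_mem, by simp⟩

lemma kPlus_le (S : Subalgebra k K) (p : Ideal S) : kPlus S p ≤ S := by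
  rintro x ⟨c, f, hf, rfl⟩
  exact add_mem (S.algebraMap_mem c) f.2

end Depictions

/-- If every element of `S` is a fraction `a / s` with `a, s ∈ R` and `s ∉ q ∩ R`, and every prime
of `R` is contracted from `S`, then `q` and `q ∩ R` have the same height. -/
theorem htOf_comap_eq_of_forall_exists_mul_eq {k K : Type*} [Field k] [Field K] [Algebra k K]
    {R S : Subalgebra k K} (h : R ≤ S)
    (surj : ∀ p : Ideal R, p.IsPrime →
      ∃ q : Ideal S, q.IsPrime ∧ q.comap (Subalgebra.inclusion h) = p)
    (q : Ideal S)
    (hfrac : ∀ f : S, ∃ a s : R, s ∉ q.comap (Subalgebra.inclusion h) ∧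
      f * Subalgebra.inclusion h s = Subalgebra.inclusion h a) (hq : q.IsPrime) :
    htOf (q.comap (Subalgebra.inclusion h)) = htOf q := by
  have key : ∀ Q₁ Q₂ : Ideal S, Q₂.IsPrime → Q₂ ≤ q →
      Q₁.comap (Subalgebra.inclusion h) ≤ Q₂.comap (Subalgebra.inclusion h) → Q₁ ≤ Q₂ := by
    intro Q₁ Q₂ hQ₂ hle hc f hf
    obtain ⟨a, s, hs, hfs⟩ := hfrac f
    have ha : a ∈ Q₁.comap (Subalgebra.inclusion h) := by
      rw [Ideal.mem_comap, ← hfs]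
      exact Q₁.mul_mem_right _ hf
    have ha₂ := Ideal.mem_comap.mp (hc ha)
    rw [← hfs] at ha₂
    exact (hQ₂.mem_or_mem ha₂).resolve_right fun hs₂ => hs (hle hs₂)
  let e : {P : PrimeSpectrum S // P.asIdeal ≤ q} →
      {P : PrimeSpectrum R // P.asIdeal ≤ q.comap (Subalgebra.inclusion h)} :=
    fun P => ⟨⟨P.1.asIdeal.comap (Subalgebra.inclusion h), P.1.2.comap _⟩, Ideal.comap_mono P.2⟩
  have he : ∀ P₁ P₂, e P₁ ≤ e P₂ ↔ P₁ ≤ P₂ := fun P₁ P₂ =>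
    ⟨fun hle => key _ _ P₂.1.2 P₂.2 hle,
      fun hle => Ideal.comap_mono (show P₁.1.asIdeal ≤ P₂.1.asIdeal from hle)⟩
  have hsurj : Function.Surjective e := by
    rintro ⟨⟨P, hP⟩, hle⟩
    obtain ⟨Q, hQ, rfl⟩ := surj P hP
    exact ⟨⟨⟨Q, hQ⟩, key Q q hq le_rfl hle⟩, rfl⟩
  exact (Order.krullDim_eq_of_orderIso
    (RelIso.ofSurjective (OrderEmbedding.ofMapLEIff e he) hsurj)).symm

/-- The kernel of a homomorphism of `k`-algebras into a field that is
of finite type as a `k`-algebra is maximal. -/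
theorem AlgHom.isMaximal_ker_of_finiteType {k A F : Type*} [Field k] [CommRing A] [Algebra k A]
    [Field F] [Algebra k F] [Algebra.FiniteType k F] (g : A →ₐ[k] F) :
    (RingHom.ker g.toRingHom).IsMaximal := by
  have : Module.Finite k F := finite_of_finite_type_of_isJacobsonRing k F
  have hint : g.toRingHom.IsIntegral := by
    apply RingHom.IsIntegral.tower_top (algebraMap k A) g.toRingHom
    have : g.toRingHom.comp (algebraMap k A) = algebraMap k F := g.comp_algebraMap
    rw [this]
    exact algebraMap_isIntegral_iff.mpr inferInstance
  exact Ideal.isMaximal_comap_of_isIntegral_of_isMaximal' g.toRingHom hint ⊥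

/-- A maximal ideal of an algebra of finite type over a field contracts to a maximal ideal along
any homomorphism of algebras. -/
theorem Ideal.isMaximal_comap_of_finiteType {k A B : Type*} [Field k] [CommRing A] [Algebra k A]
    [CommRing B] [Algebra k B] [Algebra.FiniteType k B] (f : A →ₐ[k] B) (n : Ideal B)
    [hn : n.IsMaximal] : (n.comap f).IsMaximal := by
  let : Field (B ⧸ n) := Ideal.Quotient.field n
  have : Algebra.FiniteType k (B ⧸ n) :=
    .of_surjective (Ideal.Quotient.mkₐ k n) (Ideal.Quotient.mkₐ_surjective k n)
  convert ((Ideal.Quotient.mkₐ k n).comp f).isMaximal_ker_of_finiteType using 1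
  ext x
  simp [RingHom.mem_ker, Ideal.Quotient.eq_zero_iff_mem]

/-- If `n ∈ U_{S/R}` for a depiction `S` of `R`, then every depiction of `R` is contained in
`R_{n ∩ R}`. -/
theorem IsDepiction.le_locAt_of_memU {k K : Type*} [Field k] [Field K] [Algebra k K]
    {R S S' : Subalgebra k K} (hS : IsDepiction R S) (hS' : IsDepiction R S')
    {n : Ideal S} (hn : n.IsMaximal) (hU : memU R S hS.le n) :
    S' ≤ locAt R (n.comap (Subalgebra.inclusion hS.le)) (hn.isPrime.comap _) := by
  have : Algebra.FiniteType k S := (Subalgebra.fg_iff_finiteType S).mp hS.fg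
  have hm := Ideal.isMaximal_comap_of_finiteType (Subalgebra.inclusion hS.le) n
  obtain ⟨Q, hQ, hQn⟩ := hS'.specSurj _ hm.isPrime
  obtain ⟨n', hn', hQn'⟩ := Q.exists_le_maximal hQ.ne_top
  have heq : n.comap (Subalgebra.inclusion hS.le) = n'.comap (Subalgebra.inclusion hS'.le) :=
    hm.eq_of_le (hn'.isPrime.comap _).ne_top (hQn ▸ Ideal.comap_mono hQn')
  have hlocEq : locAt R (n.comap (Subalgebra.inclusion hS.le)) (hn.isPrime.comap _) =
      locAt R (n'.comap (Subalgebra.inclusion hS'.le)) (hn'.isPrime.comap _) := by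
    simp only [heq]
  have hnoeth := (hS.memU_iff n hn).mp hU
  rw [hlocEq] at hnoeth ⊢
  obtain ⟨_, hloc⟩ := (hS'.memU_iff n' hn').mpr hnoeth
  rw [hloc]
  exact fun x hx => ⟨⟨x, hx⟩, 1, (Ideal.ne_top_iff_one n').mp hn'.ne_top, by simp⟩

/-- If `S` is a depiction of `R` and `q ∈ Z_{S/R}`, then `ght (q ∩ R) = ht_S q`. -/
theorem ght_eq_htOf_of_memZ (k K : Type*) [Field k] [IsAlgClosed k] [Field K] [Algebra k K]
    (R : Subalgebra k K) (hfrac : IsFractionRing ↥R K)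
    (S : Subalgebra k K) (hS : IsDepiction R S)
    (q : Ideal S) (hq : memZ R S hS.le q) :
    ght R (q.comap (Subalgebra.inclusion hS.le)) = htOf q := by
  obtain ⟨hqp, n, hU, hqn⟩ := hq
  have hn := hU.choose
  have hht : ∀ (S' : Subalgebra k K) (hd : IsDepiction R S') (q' : Ideal S'), q'.IsPrime →
      q'.comap (Subalgebra.inclusion hd.le) = q.comap (Subalgebra.inclusion hS.le) →
      htOf q' = htOf (q.comap (Subalgebra.inclusion hS.le)) := by
    intro S' hd q' hq' hcomap
    rw [← hcomap]
    refine (htOf_comap_eq_of_forall_exists_mul_eq hd.le hd.specSurj q' (fun f => ?_) hq').symm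
    obtain ⟨a, s, hs, hfs⟩ := mem_locAt.mp (hS.le_locAt_of_memU hd hn hU f.2)
    refine ⟨a, s, fun hmem => hs ?_, Subtype.ext hfs⟩
    rw [hcomap] at hmem
    exact Ideal.comap_mono hqn hmem
  rw [hht S hS q hqp rfl, ght]
  apply le_antisymm
  · exact sInf_le ⟨S, hS, q, hqp, rfl, (hht S hS q hqp rfl).symm⟩
  · refine le_sInf ?_
    rintro _ ⟨S', hd, q', hq', hcomap, rfl⟩
    exact (hht S' hd q' hq' hcomap).ge
end

section
/- Suppose R is noetherian in codimension 1, with witnessing depiction S, and set T := ⋂_{n ∈ U_{S/R}} S_n ⊆ Frac(R). Then T is contained in the integral closure of S in Frac(R); in particular, T is an integral extension of S. -/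
open Polynomial in
/-- Over a unique factorization domain, an algebraic element that becomes integral after
multiplication by a scalar outside each principal prime is integral. -/
theorem isIntegral_of_forall_prime_exists_smul {P K : Type*} [CommRing P] [IsDomain P]
    [UniqueFactorizationMonoid P] [Field K] [Algebra P K] [FaithfulSMul P K] {x : K}
    (hx : IsAlgebraic P x) (h : ∀ π : P, Prime π → ∃ s : P, ¬ π ∣ s ∧ IsIntegral P (s • x)) :
    IsIntegral P x := by
  let F := FractionRing P
  let _ : Algebra F K := FractionRing.liftAlgebra P K
  have hxF : IsIntegral F x :=
    ((IsFractionRing.isAlgebraic_iff P F K).mp hx).isIntegral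
  have hcoeff : ∀ i, ∃ c : P, algebraMap P F c = (minpoly F x).coeff i := by
    intro i
    obtain ⟨a, b, hab, hc⟩ :=
      IsFractionRing.exists_reduced_fraction (A := P) (K := F) ((minpoly F x).coeff i)
    suffices hb : IsUnit (b : P) by
      obtain ⟨u, hu⟩ := hb
      refine ⟨a * ↑u⁻¹, ?_⟩
      rw [← hc, IsLocalization.eq_mk'_iff_mul_eq, ← map_mul, ← hu, mul_assoc, Units.inv_mul,
        mul_one]
    by_contra hb
    obtain ⟨π, hπ, hπb⟩ :=
      WfDvdMonoid.exists_irreducible_factor hb (nonZeroDivisors.coe_ne_zero b)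
    have hπ' : Prime π := hπ.prime
    obtain ⟨s, hs, hsx⟩ := h π hπ'
    have key : ((minpoly P (s • x)).coeff i : P) * b
        = a * s ^ ((minpoly F x).natDegree - i) := by
      apply IsFractionRing.injective P F
      have h1 : minpoly F (algebraMap P F s • x) = (minpoly F x).scaleRoots (algebraMap P F s) :=
        IsIntegrallyClosed.minpoly_smul
          ((map_ne_zero_iff _ (IsFractionRing.injective P F)).mpr
            fun h0 : s = 0 => hs (h0 ▸ dvd_zero π)) hxF
      rw [algebraMap_smul, minpoly.isIntegrallyClosed_eq_field_fractions' F hsx] at h1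
      have h2 := congrArg (fun p => p.coeff i) h1
      simp only [coeff_map, coeff_scaleRoots] at h2
      have h3 : (minpoly F x).coeff i * algebraMap P F b = algebraMap P F a := by
        rw [← hc, IsLocalization.mk'_spec]
      rw [map_mul, map_mul, map_pow, h2, ← h3]
      ring
    have hdvd : π ∣ a * s ^ ((minpoly F x).natDegree - i) := key ▸ hπb.mul_left _
    rcases hπ'.dvd_or_dvd hdvd with ha | hs'
    · exact hπ.not_isUnit (hab ha hπb)
    · exact hs (hπ'.dvd_of_dvd_pow hs')
  have hlift : minpoly F x ∈ lifts (algebraMap P F) := by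
    rw [lifts_iff_coeff_lifts]
    exact hcoeff
  obtain ⟨q, hq, -, hqm⟩ := lifts_and_degree_eq_and_monic hlift (minpoly.monic hxF)
  refine ⟨q, hqm, ?_⟩
  have := minpoly.aeval F x
  rwa [← hq, aeval_map_algebraMap] at this

/-- A nonzero prime with no primes strictly between it and zero has height one. -/
theorem htOf_eq_one {A : Type*} [CommRing A] [IsDomain A] {q : Ideal A} (hq : q.IsPrime)
    (h0 : q ≠ ⊥) (h : ∀ p : Ideal A, p.IsPrime → p ≤ q → p = ⊥ ∨ p = q) : htOf q = 1 := by
  apply le_antisymm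
  · refine Order.krullDim_le_one_iff.mpr fun ⟨p, hp⟩ => ?_
    rcases h p.asIdeal p.isPrime hp with hb | ht
    · left
      rintro ⟨r, hr⟩ -
      change p.asIdeal ≤ r.asIdeal
      exact hb ▸ bot_le
    · right
      rintro ⟨r, hr⟩ -
      change r.asIdeal ≤ p.asIdeal
      exact ht ▸ hr
  · rw [htOf, Order.one_le_krullDim_iff]
    refine ⟨⟨⟨⊥, Ideal.isPrime_bot⟩, bot_le⟩, ⟨⟨q, hq⟩, le_rfl⟩, ?_⟩
    change (⟨⊥, Ideal.isPrime_bot⟩ : PrimeSpectrum A) < ⟨q, hq⟩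
    rw [← PrimeSpectrum.asIdeal_lt_asIdeal]
    exact bot_lt_iff_ne_bot.mpr h0

/-- In a unique factorization domain, a nonzero prime contained in a principal prime `(π)`
equals `(π)`. -/
theorem Ideal.IsPrime.eq_span_of_le_span_prime {P : Type*} [CommRing P] [IsDomain P]
    [UniqueFactorizationMonoid P] {π : P} (hπ : Prime π) {p : Ideal P} (hp : p.IsPrime)
    (hle : p ≤ Ideal.span {π}) (h0 : p ≠ ⊥) : p = Ideal.span {π} := by
  obtain ⟨σ, hσp, hσ⟩ := hp.exists_mem_prime_of_ne_bot h0
  refine le_antisymm hle ?_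
  have hdvd : π ∣ σ := Ideal.mem_span_singleton.mp (hle hσp)
  have := (hπ.irreducible.associated_of_dvd hσ.irreducible hdvd)
  rw [Ideal.span_singleton_le_iff_mem]
  exact p.mem_of_dvd this.symm.dvd hσp

/-- For an integral extension `S` of a unique factorization domain `P`, a nonzero ideal of `S`
lying in no height one prime meets the complement of every principal prime of `P`. -/
theorem exists_algebraMap_mem_of_forall_htOf_eq_one {P S : Type*} [CommRing P] [IsDomain P]
    [UniqueFactorizationMonoid P] [CommRing S] [IsDomain S] [Algebra P S]
    [Algebra.IsIntegral P S] {J : Ideal S} (hJ0 : J ≠ ⊥)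
    (hJ : ∀ q : Ideal S, q.IsPrime → htOf q = 1 → ¬ J ≤ q) {π : P} (hπ : Prime π) :
    ∃ s : P, ¬ π ∣ s ∧ algebraMap P S s ∈ J := by
  have hspan : (Ideal.span {π}).IsPrime := (Ideal.span_singleton_prime hπ.ne_zero).mpr hπ
  by_contra! hcon
  obtain ⟨q, hq, hJq, hdis⟩ := Ideal.exists_le_prime_disjoint J
    ((Ideal.span {π}).primeCompl.map (algebraMap P S)) (by
      rw [Set.disjoint_left]
      rintro _ hy ⟨s, hs, rfl⟩
      exact hcon s (fun hd => hs (Ideal.mem_span_singleton.mpr hd)) hy)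
  have hle : q.comap (algebraMap P S) ≤ Ideal.span {π} := by
    intro s hs
    by_contra hn
    exact Set.disjoint_left.mp hdis hs ⟨s, hn, rfl⟩
  have hq0 : q ≠ ⊥ := fun h => hJ0 (le_bot_iff.mp (h ▸ hJq))
  have hcomap : ∀ p : Ideal S, p.IsPrime → p ≤ q → p ≠ ⊥ →
      p.comap (algebraMap P S) = Ideal.span {π} := fun p hp hpq hp0 =>
    (hp.comap (algebraMap P S)).eq_span_of_le_span_prime hπ
      ((Ideal.comap_mono hpq).trans hle) fun h => hp0 (Ideal.eq_bot_of_comap_eq_bot h)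
  refine hJ q hq (htOf_eq_one hq hq0 fun p hp hpq => ?_) hJq
  by_contra! hne
  have hlt := Ideal.IsIntegral.comap_lt_comap (R := P) (lt_of_le_of_ne hpq hne.2)
  rw [hcomap p hp hpq hne.1, hcomap q hq le_rfl hq0] at hlt
  exact lt_irrefl _ hlt

/-- If `R` is noetherian in codimension 1 with witnessing depiction `S` and
`T := ⋂_{n ∈ U_{S/R}} S_n`, then `T` is contained in the integral closure of `S` in
`Frac R = K`; in particular every element of `T` is integral over `S`. -/
theorem depT_le_integralClosure (k K : Type*) [Field k] [IsAlgClosed k] [Field K] [Algebra k K]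
    (R : Subalgebra k K) (hfrac : IsFractionRing ↥R K)
    (S : Subalgebra k K) (hS : IsDepiction R S) (hw : Witnessing R S hS.le) :
    ∀ x : K, x ∈ depT R S hS.le → x ∈ integralClosure ↥S K := by
  intro x hx
  have hden : ∀ n : Ideal S, memU R S hS.le n →
      ∃ a s : S, s ∉ n ∧ x * (s : K) = (a : K) := fun n hn =>
    mem_locAt.mp (Algebra.mem_sInf.mp hx _ ⟨n, hn.1, hn, rfl⟩)
  have : Algebra.FiniteType k S := S.fg_iff_finiteType.mp hS.fg
  obtain ⟨d, g, hg, hgint⟩ := exists_integral_inj_algHom_of_fg k S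
  let _ : Algebra (MvPolynomial (Fin d) k) S := g.toRingHom.toAlgebra
  have : Algebra.IsIntegral (MvPolynomial (Fin d) k) S := ⟨hgint⟩
  let _ : Algebra (MvPolynomial (Fin d) k) K :=
    ((algebraMap S K).comp g.toRingHom).toAlgebra
  have : IsScalarTower (MvPolynomial (Fin d) k) S K := IsScalarTower.of_algebraMap_eq' rfl
  have : FaithfulSMul (MvPolynomial (Fin d) k) K :=
    (faithfulSMul_iff_algebraMap_injective _ _).mpr (Subtype.val_injective.comp hg)
  let J : Ideal S := (1 : Submodule S K).comap (LinearMap.toSpanSingleton S K x)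
  have hJmem : ∀ s : S, s ∈ J ↔ ∃ a : S, (a : K) = s * x := fun s => by
    simp [J, Submodule.mem_one, Algebra.smul_def]
  have hJU : ∀ n : Ideal S, memU R S hS.le n → ¬ J ≤ n := fun n hn hle => by
    obtain ⟨a, s, hs, h⟩ := hden n hn
    exact hs (hle ((hJmem s).mpr ⟨a, by rw [← h, mul_comm]⟩))
  have hJ0 : J ≠ ⊥ := fun h => by
    obtain ⟨n, hn⟩ := hS.nonempty
    exact hJU n hn (h ▸ bot_le)
  have hJ1 : ∀ q : Ideal S, q.IsPrime → htOf q = 1 → ¬ J ≤ q := fun q hq hq1 hle => by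
    obtain ⟨-, n, hn, hqn⟩ := hw q hq hq1
    exact hJU n hn (hle.trans hqn)
  have hint : ∀ a : S, IsIntegral (MvPolynomial (Fin d) k) (a : K) := fun a =>
    (Algebra.IsIntegral.isIntegral a).algebraMap
  have halg : IsAlgebraic (MvPolynomial (Fin d) k) x := by
    obtain ⟨s, hs, hs0⟩ := Submodule.exists_mem_ne_zero_of_ne_bot hJ0
    obtain ⟨a, ha⟩ := (hJmem s).mp hs
    have hsK : (s : K) ≠ 0 := by simpa using hs0
    have hxa : x = a * (s : K)⁻¹ := by rw [ha]; field_simp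
    rw [hxa]
    exact (hint a).isAlgebraic.mul (hint s).isAlgebraic.inv
  refine IsIntegral.tower_top (R := MvPolynomial (Fin d) k)
    (isIntegral_of_forall_prime_exists_smul halg fun π hπ => ?_)
  obtain ⟨s, hs, hsJ⟩ := exists_algebraMap_mem_of_forall_htOf_eq_one hJ0 hJ1 hπ
  obtain ⟨a, ha⟩ := (hJmem _).mp hsJ
  refine ⟨s, hs, ?_⟩
  rw [Algebra.smul_def, IsScalarTower.algebraMap_apply _ S K]
  exact (ha ▸ hint a : IsIntegral _ ((algebraMap _ S s : K) * x))
end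

section
/- Suppose R is noetherian in codimension 1, with witnessing depiction S, and set T := ⋂_{n ∈ U_{S/R}} S_n ⊆ Frac(R). Then the morphism Spec T → Spec S, t ↦ t ∩ S, is surjective. -/
/-- In a unique factorization domain, a prime ideal strictly below a principal prime ideal
is zero. -/
lemma Ideal.eq_bot_of_lt_span_singleton_prime {A : Type*} [CommRing A] [IsDomain A]
    [UniqueFactorizationMonoid A] {π : A} (hπ : Prime π) {q : Ideal A} (hq : q.IsPrime)
    (hlt : q < Ideal.span {π}) : q = ⊥ := by
  by_contra hne
  obtain ⟨r, hrq, hr⟩ := hq.exists_mem_prime_of_ne_bot hne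
  have hdvd : π ∣ r := Ideal.mem_span_singleton.mp (hlt.le hrq)
  have hass : Associated π r := hπ.associated_of_dvd hr hdvd
  refine hlt.not_ge ((Ideal.span_singleton_le_iff_mem _).mpr ?_)
  exact q.mem_of_dvd hass.symm.dvd hrq

/-- In an integral extension of a unique factorization domain, a prime lying over a principal
prime ideal generated by a prime element has height one. -/
lemma htOf_eq_one_of_comap_eq_span_singleton {A S : Type*} [CommRing A] [IsDomain A]
    [UniqueFactorizationMonoid A] [CommRing S] [IsDomain S] [Algebra A S] [FaithfulSMul A S]
    [Algebra.IsIntegral A S] {π : A} (hπ : Prime π) {P : Ideal S} (hP : P.IsPrime)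
    (hcomap : P.comap (algebraMap A S) = Ideal.span {π}) : htOf P = 1 := by
  have hbot : ∀ Q : Ideal S, Q.IsPrime → Q < P → Q = ⊥ := by
    intro Q hQ hlt
    have hlt' := Ideal.IsIntegral.comap_lt_comap (R := A) hlt
    rw [hcomap] at hlt'
    exact Ideal.eq_bot_of_comap_eq_bot
      (Ideal.eq_bot_of_lt_span_singleton_prime hπ (hQ.comap _) hlt')
  have hPne : P ≠ ⊥ := by
    rintro rfl
    have hmem : π ∈ Ideal.comap (algebraMap A S) ⊥ := by
      rw [hcomap]
      exact Ideal.mem_span_singleton_self π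
    exact hπ.ne_zero ((FaithfulSMul.algebraMap_eq_zero_iff A S).mp (by simpa using hmem))
  refine le_antisymm ?_ ?_
  · refine Order.krullDim_le_one_iff.mpr fun x => ?_
    by_cases hx : x.1.asIdeal = P
    · exact Or.inr fun y _ => show y.1.asIdeal ≤ x.1.asIdeal from y.2.trans_eq hx.symm
    · refine Or.inl fun y _ => show x.1.asIdeal ≤ y.1.asIdeal from ?_
      rw [hbot _ x.1.isPrime (lt_of_le_of_ne x.2 hx)]
      exact bot_le
  · refine Order.one_le_krullDim_iff.mpr
      ⟨⟨⟨⊥, Ideal.isPrime_bot⟩, bot_le⟩, ⟨⟨P, hP⟩, le_rfl⟩, ?_⟩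
    exact show (⊥ : Ideal S) < P from bot_lt_iff_ne_bot.mpr hPne

/-- An element of the fraction field of a unique factorization domain lies in the domain if, for
each prime element `π`, it is cleared by a power of an element that `π` does not divide. -/
lemma mem_range_algebraMap_of_forall_prime {A L : Type*} [CommRing A] [IsDomain A]
    [UniqueFactorizationMonoid A] [Field L] [Algebra A L] [IsFractionRing A L] {c : L} (m : ℕ)
    (h : ∀ π : A, Prime π → ∃ a : A, ¬ π ∣ a ∧ c * algebraMap A L a ^ m ∈ (algebraMap A L).range) :
    c ∈ (algebraMap A L).range := by
  by_cases hu : IsUnit (IsFractionRing.den A c : A)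
  · exact IsFractionRing.isInteger_of_isUnit_den hu
  obtain ⟨π, hirr, hden⟩ := WfDvdMonoid.exists_irreducible_factor hu
    (nonZeroDivisors.ne_zero (IsFractionRing.den A c).2)
  have hπ : Prime π := hirr.prime
  obtain ⟨a, ha, b, hb⟩ := h π hπ
  have hden0 : algebraMap A L (IsFractionRing.den A c) ≠ 0 :=
    IsFractionRing.to_map_ne_zero_of_mem_nonZeroDivisors (IsFractionRing.den A c).2
  have hc : c * algebraMap A L (IsFractionRing.den A c) =
      algebraMap A L (IsFractionRing.num A c) := by
    have := IsFractionRing.mk'_num_den' A c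
    rw [← eq_div_iff hden0, this]
  have hmul : IsFractionRing.num A c * a ^ m = IsFractionRing.den A c * b := by
    apply IsFractionRing.injective A L
    rw [map_mul, map_mul, map_pow, hb, ← hc]
    ring
  have hnum : π ∣ IsFractionRing.num A c := by
    have hd : π ∣ IsFractionRing.num A c * a ^ m := hmul ▸ hden.mul_right b
    exact (hπ.dvd_or_dvd hd).resolve_right fun hd' => ha (hπ.dvd_of_dvd_pow hd')
  exact absurd (IsFractionRing.num_den_reduced A c hnum hden) hπ.not_isUnit

/-- Integrality over a unique factorization domain can be checked up to multiplication by elements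
avoiding each prime element in turn. -/
lemma isIntegral_of_forall_prime {A E : Type*} [CommRing A] [IsDomain A]
    [UniqueFactorizationMonoid A] [Field E] [Algebra A E] [FaithfulSMul A E] {x : E}
    (hx : IsAlgebraic A x)
    (h : ∀ π : A, Prime π → ∃ a : A, ¬ π ∣ a ∧ IsIntegral A (a • x)) : IsIntegral A x := by
  let L := FractionRing A
  let : Algebra L E := FractionRing.liftAlgebra A E
  have : IsScalarTower A L E := FractionRing.isScalarTower_liftAlgebra A E
  have hxL : IsIntegral L x :=
    ((IsFractionRing.isAlgebraic_iff A L E).mp hx).isIntegral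
  have hlifts : minpoly L x ∈ Polynomial.lifts (algebraMap A L) := by
    refine (Polynomial.lifts_iff_coeff_lifts _).mpr fun i => ?_
    refine mem_range_algebraMap_of_forall_prime ((minpoly L x).natDegree - i) fun π hπ => ?_
    obtain ⟨a, ha, hint⟩ := h π hπ
    refine ⟨a, ha, ?_⟩
    have ha0 : algebraMap A L a ≠ 0 := by
      rw [Ne, FaithfulSMul.algebraMap_eq_zero_iff A L]
      rintro rfl
      exact ha (dvd_zero π)
    rw [← Polynomial.coeff_scaleRoots, ← IsIntegrallyClosed.minpoly_smul ha0 hxL,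
      algebraMap_smul, minpoly.isIntegrallyClosed_eq_field_fractions' L hint,
      Polynomial.coeff_map]
    exact ⟨_, rfl⟩
  obtain ⟨p, hp, -, hmonic⟩ :=
    Polynomial.lifts_and_natDegree_eq_and_monic hlifts (minpoly.monic hxL)
  refine ⟨p, hmonic, ?_⟩
  rw [← Polynomial.aeval_def, ← Polynomial.aeval_map_algebraMap L, hp, minpoly.aeval]

/-- Let `S` be integral over a unique factorization domain `A`. An element `x` of a field
containing `S` that is algebraic over `A` and lies in `S_P` for each height one prime `P`
is integral over `A`. -/
lemma isIntegral_of_forall_htOf_eq_one {A S E : Type*} [CommRing A] [IsDomain A]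
    [UniqueFactorizationMonoid A] [CommRing S] [IsDomain S] [Algebra A S] [FaithfulSMul A S]
    [Algebra.IsIntegral A S] [Field E] [Algebra A E] [FaithfulSMul A E] [Algebra S E]
    [IsScalarTower A S E] {x : E} (hx : IsAlgebraic A x)
    (h : ∀ P : Ideal S, P.IsPrime → htOf P = 1 →
      ∃ s : S, s ∉ P ∧ s • x ∈ LinearMap.range (Algebra.linearMap S E)) : IsIntegral A x := by
  refine isIntegral_of_forall_prime hx fun π hπ => ?_
  let I : Ideal S :=
    (LinearMap.range (Algebra.linearMap S E)).comap (LinearMap.toSpanSingleton S E x)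
  have hI : ¬ I.comap (algebraMap A S) ≤ Ideal.span {π} := by
    intro hle
    have := (Ideal.span_singleton_prime hπ.ne_zero).mpr hπ
    obtain ⟨P, hIP, hP, hcomap⟩ := Ideal.exists_ideal_over_prime_of_isIntegral _ I hle
    obtain ⟨s, hs, hsx⟩ := h P hP (htOf_eq_one_of_comap_eq_span_singleton hπ hP hcomap)
    exact hs (hIP hsx)
  obtain ⟨a, ⟨b, hb⟩, ha⟩ := SetLike.not_le_iff_exists.mp hI
  refine ⟨a, fun hd => ha (Ideal.mem_span_singleton.mpr hd), ?_⟩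
  have hb' : algebraMap S E b = a • x := by simpa using hb
  rw [← hb']
  exact (Algebra.IsIntegral.isIntegral b).algebraMap

/-- For a finitely generated subalgebra `S` of `K` with fraction field `K`, an element of `K` lying
in `S_P` for each height one prime `P` of `S` is integral over `S`. -/
lemma Subalgebra.FG.isIntegral_of_forall_htOf_eq_one {k K : Type*} [Field k] [Field K]
    [Algebra k K] {S : Subalgebra k K} (hfg : S.FG) {x : K}
    (hx : ∃ a s : S, s ≠ 0 ∧ x * (s : K) = a)
    (h : ∀ (P : Ideal S) (hP : P.IsPrime), htOf P = 1 → x ∈ locAt S P hP) :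
    IsIntegral S x := by
  have : Algebra.FiniteType k S := S.fg_iff_finiteType.mp hfg
  obtain ⟨d, g, hinj, hint⟩ := exists_integral_inj_algHom_of_fg k S
  let A := MvPolynomial (Fin d) k
  let : Algebra A S := g.toRingHom.toAlgebra
  let : Algebra A K := ((algebraMap S K).comp g.toRingHom).toAlgebra
  have : IsScalarTower A S K := IsScalarTower.of_algebraMap_eq fun _ => rfl
  have : Algebra.IsIntegral A S := ⟨hint⟩
  have : FaithfulSMul A S := (faithfulSMul_iff_algebraMap_injective A S).mpr hinj
  have : FaithfulSMul A K := (faithfulSMul_iff_algebraMap_injective A K).mpr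
    (Subtype.val_injective.comp hinj)
  have halg (s : S) : IsAlgebraic A (s : K) :=
    ((Algebra.IsIntegral.isIntegral (R := A) s).algebraMap (B := K)).isAlgebraic
  have hxalg : IsAlgebraic A x := by
    obtain ⟨a, s, hs, has⟩ := hx
    have hs0 : (s : K) ≠ 0 := by simpa using hs
    rw [eq_div_of_mul_eq hs0 has, div_eq_mul_inv]
    exact (halg a).mul (halg s).inv
  refine (_root_.isIntegral_of_forall_htOf_eq_one (S := S) hxalg fun P hP hht => ?_).tower_top
  obtain ⟨a, s, hs, has⟩ := h P hP hht
  refine ⟨s, hs, a, ?_⟩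
  rw [Algebra.smul_def, mul_comm]
  exact has.symm

/-- If `R` is noetherian in codimension 1 with witnessing depiction `S` and
`T := ⋂_{n ∈ U_{S/R}} S_n`, then `Spec T → Spec S`, `t ↦ t ∩ S`, is surjective. -/
theorem depT_spec_surjective_onto_S (k K : Type*) [Field k] [IsAlgClosed k] [Field K] [Algebra k K]
    (R : Subalgebra k K) (hfrac : IsFractionRing ↥R K)
    (S : Subalgebra k K) (hS : IsDepiction R S) (hw : Witnessing R S hS.le) :
    ∀ q : Ideal S, q.IsPrime →
      ∃ t : Ideal (depT R S hS.le), t.IsPrime ∧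
        t.comap (Subalgebra.inclusion (le_depT R S hS.le)) = q := by
  have hle := le_depT R S hS.le
  let : Algebra S (depT R S hS.le) := (Subalgebra.inclusion hle).toRingHom.toAlgebra
  have : IsScalarTower S (depT R S hS.le) K := IsScalarTower.of_algebraMap_eq fun _ => rfl
  have hfracS (x : K) : ∃ a s : S, s ≠ 0 ∧ x * (s : K) = a := by
    obtain ⟨a, s, hs, hx⟩ := IsFractionRing.div_surjective (A := R) x
    have hs0 : (s : K) ≠ 0 := by simpa using nonZeroDivisors.ne_zero hs
    refine ⟨Subalgebra.inclusion hS.le a, Subalgebra.inclusion hS.le s, ?_, ?_⟩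
    · exact fun h => hs0 (congrArg Subtype.val h)
    · rw [← hx]
      exact div_mul_cancel₀ _ hs0
  have : Algebra.IsIntegral S (depT R S hS.le) := by
    refine ⟨fun x => ?_⟩
    refine (isIntegral_algebraMap_iff (B := K) Subtype.val_injective).mp ?_
    refine hS.fg.isIntegral_of_forall_htOf_eq_one (hfracS x) fun P hP hht => ?_
    obtain ⟨-, n, hn, hPn⟩ := hw P hP hht
    have hmax := hn.1
    have hxn : (x : K) ∈ locAt S n hmax.isPrime :=
      (sInf_le (a := locAt S n hmax.isPrime) ⟨n, hmax, hn, rfl⟩ : depT R S hS.le ≤ _) x.2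
    obtain ⟨a, s, hs, has⟩ := hxn
    exact ⟨a, s, fun h => hs (hPn h), has⟩
  intro q hq
  have hker : RingHom.ker (algebraMap S (depT R S hS.le)) = ⊥ :=
    (RingHom.injective_iff_ker_eq_bot _).mp (Subalgebra.inclusion_injective hle)
  exact Ideal.exists_ideal_over_prime_of_isIntegral_of_isDomain q (hker.trans_le bot_le)
end

section
/- Suppose R is noetherian in codimension 1, with witnessing depiction S, and set T := ⋂_{n ∈ U_{S/R}} S_n ⊆ Frac(R). Then T is a depiction of R; that is, T is a finitely generated k-algebra, the map Spec T → Spec R, t ↦ t ∩ R, is surjective, and U_{T/R} = { t ∈ Max T : R_{t∩R} is noetherian } ≠ ∅. -/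
section CodimensionOne

/-- In a vector space over the fraction field of a noetherian UFD `P`, the vectors which lie in a
finitely generated `P`-submodule `N` locally at every height one prime of `P` are contained in a
single finitely generated `P`-submodule. -/
lemma exists_fg_submodule_of_forall_prime {P F V : Type*} [CommRing P] [IsDomain P]
    [UniqueFactorizationMonoid P] [IsNoetherianRing P] [Field F] [Algebra P F] [IsFractionRing P F]
    [AddCommGroup V] [Module F V] [Module P V] [IsScalarTower P F V] [FiniteDimensional F V]
    (N : Submodule P V) (hN : N.FG) :
    ∃ L : Submodule P V, L.FG ∧
      ∀ x, (∀ π : P, Prime π → ∃ c : P, ¬ π ∣ c ∧ c • x ∈ N) → x ∈ L := by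
  classical
  obtain ⟨G, rfl⟩ := hN
  let b := Module.finBasis F V
  obtain ⟨d, hd⟩ := IsLocalization.exist_integer_multiples (nonZeroDivisors P)
    (G ×ˢ Finset.univ) (fun a : V × Fin _ => b.repr a.1 a.2)
  have hd0 : algebraMap P F d ≠ 0 := IsFractionRing.to_map_ne_zero_of_mem_nonZeroDivisors d.2
  have hG : ∀ y ∈ Submodule.span P (G : Set V), ∀ i,
      IsLocalization.IsInteger P ((d : P) • b.repr y i) := by
    intro y hy i
    induction hy using Submodule.span_induction with
    | mem y hy => exact hd (y, i) (by simpa using hy)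
    | zero => simpa using IsLocalization.isInteger_zero
    | add y z _ _ hy hz => simpa [smul_add] using IsLocalization.isInteger_add hy hz
    | smul a y _ hy =>
      have : b.repr (a • y) i = a • b.repr y i := by
        rw [← algebraMap_smul F a y, map_smul, Finsupp.smul_apply, algebraMap_smul]
      rw [this, smul_comm]
      exact IsLocalization.isInteger_smul hy
  refine ⟨Submodule.span P (Set.range fun i => (algebraMap P F d)⁻¹ • b i),
    Submodule.fg_span (Set.finite_range _), fun x hx => ?_⟩
  have key : ∀ i, IsLocalization.IsInteger P ((d : P) • b.repr x i) := by
    intro i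
    set y := (d : P) • b.repr x i with hy
    apply IsFractionRing.isInteger_of_isUnit_den
    by_contra hu
    obtain ⟨π, hπ, hdvd⟩ := WfDvdMonoid.exists_irreducible_factor hu
      (nonZeroDivisors.ne_zero (IsFractionRing.den P y).2)
    obtain ⟨c, hc, hcx⟩ := hx π hπ.prime
    apply hc
    refine hdvd.trans ?_
    obtain ⟨z, hz⟩ := hG _ hcx i
    have hcy : algebraMap P F z = algebraMap P F c * y := by
      rw [hz, ← algebraMap_smul F c x, map_smul, Finsupp.smul_apply, hy]
      rw [smul_eq_mul, mul_smul_comm]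
    refine (IsFractionRing.num_den_reduced P y).symm.dvd_of_dvd_mul_right ⟨z, ?_⟩
    apply IsFractionRing.injective P F
    have hnd : y * algebraMap P F (IsFractionRing.den P y) =
        algebraMap P F (IsFractionRing.num P y) := by
      conv_lhs => rw [← IsFractionRing.mk'_num_den P y]
      simpa only [IsFractionRing.mk'_num_den] using
        IsLocalization.mk'_spec F (IsFractionRing.num P y) (IsFractionRing.den P y)
    rw [map_mul, map_mul, hcy, ← hnd]
    ring
  rw [← b.sum_repr x]
  refine Submodule.sum_mem _ fun i _ => ?_
  obtain ⟨z, hz⟩ := key i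
  have : b.repr x i • b i = z • ((algebraMap P F d)⁻¹ • b i) := by
    rw [← algebraMap_smul F z, smul_smul, hz, Algebra.smul_def]
    congr 1
    field_simp
  rw [this]
  exact Submodule.smul_mem _ _ (Submodule.subset_span ⟨i, rfl⟩)

/-- In an integral extension of a UFD, a prime lying over a principal prime has height one. -/
lemma htOf_eq_one_of_comap_eq_span {P A : Type*} [CommRing P] [IsDomain P]
    [UniqueFactorizationMonoid P] [CommRing A] [IsDomain A] [Algebra P A] [FaithfulSMul P A]
    [Algebra.IsIntegral P A] {π : P} (hπ : Prime π) (q : Ideal A) [hq : q.IsPrime]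
    (hqπ : q.comap (algebraMap P A) = Ideal.span {π}) : htOf q = 1 := by
  have hπq : algebraMap P A π ∈ q := by
    rw [← Ideal.mem_comap, hqπ]
    exact Ideal.mem_span_singleton_self π
  have hne : algebraMap P A π ≠ 0 := by
    simpa using hπ.ne_zero
  refine le_antisymm ?_ ?_
  · refine Order.krullDim_le_one_iff.mpr fun p => ?_
    have := p.1.isPrime
    by_cases hp : p.1.asIdeal = ⊥
    · refine Or.inl fun r _ => ?_
      change p.1.asIdeal ≤ r.1.asIdeal
      rw [hp]
      exact bot_le
    · refine Or.inr fun r _ => ?_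
      change r.1.asIdeal ≤ p.1.asIdeal
      refine r.2.trans (not_lt_iff_le_imp_ge.mp (fun hlt => ?_) p.2)
      have hlt' := Ideal.IsIntegral.comap_lt_comap (R := P) hlt
      obtain ⟨a, ha, hpa⟩ := Ideal.IsPrime.exists_mem_prime_of_ne_bot
        (p.1.isPrime.comap (algebraMap P A)) (Ideal.IsIntegral.comap_ne_bot P hp)
      have hdvd : π ∣ a := by
        rw [← Ideal.mem_span_singleton, ← hqπ]
        exact hlt'.le ha
      refine hlt'.not_ge ?_
      rw [hqπ, Ideal.span_singleton_le_iff_mem]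
      exact Ideal.mem_of_dvd _ (hπ.associated_of_dvd hpa hdvd).symm.dvd ha
  · refine Order.one_le_krullDim_iff.mpr ⟨⟨⟨⊥, Ideal.isPrime_bot⟩, bot_le⟩, ⟨⟨q, hq⟩, le_rfl⟩, ?_⟩
    change (⊥ : Ideal A) < q
    exact bot_lt_iff_ne_bot.mpr fun h => hne (by simpa [h] using hπq)

/-- If a domain `A` is a finite extension of a noetherian UFD, then every ring between `A` and the
intersection of the localizations of `A` at its height one primes is finite over `A`. -/
lemma finite_of_le_codimOne (P : Type*) {A K : Type*} [CommRing P] [IsDomain P]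
    [UniqueFactorizationMonoid P] [IsNoetherianRing P] [CommRing A] [IsDomain A] [Algebra P A]
    [FaithfulSMul P A] [Module.Finite P A] [Field K] [Algebra A K] [IsFractionRing A K]
    (T : Subalgebra A K)
    (hT : ∀ x ∈ T, ∀ q : Ideal A, q.IsPrime → htOf q = 1 →
      ∃ s ∉ q, ∃ a : A, algebraMap A K s * x = algebraMap A K a) :
    Module.Finite A T := by
  let : Algebra P K := ((algebraMap A K).comp (algebraMap P A)).toAlgebra
  have : IsScalarTower P A K := .of_algebraMap_eq fun _ => rfl
  have : FaithfulSMul P K := by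
    rw [faithfulSMul_iff_algebraMap_injective]
    exact (IsFractionRing.injective A K).comp (FaithfulSMul.algebraMap_injective P A)
  let : Algebra (FractionRing P) K := FractionRing.liftAlgebra P K
  let N : Submodule P K := LinearMap.range (IsScalarTower.toAlgHom P A K).toLinearMap
  have hN : N.FG := by
    change (LinearMap.range (IsScalarTower.toAlgHom P A K).toLinearMap).FG
    rw [← Submodule.map_top]
    exact Module.Finite.fg_top.map _
  have hfin : FiniteDimensional (FractionRing P) K := by
    obtain ⟨G, hG⟩ := hN
    refine ⟨⟨G, ?_⟩⟩
    have hsub : ∀ y ∈ N, y ∈ Submodule.span (FractionRing P) (G : Set K) := fun y hy =>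
      Submodule.span_le_restrictScalars P (FractionRing P) (G : Set K) (hG ▸ hy)
    rw [eq_top_iff]
    rintro x -
    obtain ⟨a, b, hb, rfl⟩ := IsFractionRing.div_surjective (A := A) x
    have hb0 : b ≠ 0 := nonZeroDivisors.ne_zero hb
    obtain ⟨c, hc, hc0⟩ := Submodule.exists_mem_ne_zero_of_ne_bot
      (Ideal.IsIntegral.comap_ne_bot P (I := Ideal.span {b}) (by simpa using hb0))
    obtain ⟨e, he⟩ := Ideal.mem_span_singleton.mp (Ideal.mem_comap.mp hc)
    have hbK : algebraMap A K b ≠ 0 := by simpa using hb0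
    have hcK : algebraMap (FractionRing P) K (algebraMap P _ c) = algebraMap A K (b * e) := by
      rw [← he, ← IsScalarTower.algebraMap_apply, ← IsScalarTower.algebraMap_apply]
    have hcK0 : algebraMap A K (b * e) ≠ 0 := by
      rw [← hcK]
      simpa using hc0
    have : algebraMap A K a / algebraMap A K b =
        (algebraMap P (FractionRing P) c)⁻¹ • algebraMap A K (a * e) := by
      rw [Algebra.smul_def, map_inv₀, hcK, map_mul, map_mul]
      rw [map_mul] at hcK0
      have := right_ne_zero_of_mul hcK0
      field_simp
    rw [this]
    exact Submodule.smul_mem _ _ (hsub _ ⟨_, rfl⟩)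
  obtain ⟨L, hL, hTL⟩ := exists_fg_submodule_of_forall_prime (F := FractionRing P) N hN
  have hle : (Subalgebra.toSubmodule T).restrictScalars P ≤ L := by
    intro x hx
    refine hTL x fun π hπ => ?_
    by_contra! hcon
    let J : Ideal A :=
      (LinearMap.range (Algebra.linearMap A K)).comap (LinearMap.toSpanSingleton A K x)
    have hJ : ∀ s, s ∈ J ↔ ∃ a, algebraMap A K a = algebraMap A K s * x := by
      intro s
      simp [J, Algebra.smul_def]
    have hJπ : J.comap (algebraMap P A) ≤ Ideal.span {π} := by
      intro c hc
      rw [Ideal.mem_span_singleton]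
      by_contra hcπ
      refine hcon c hcπ ?_
      obtain ⟨a, ha⟩ := (hJ _).mp (Ideal.mem_comap.mp hc)
      refine ⟨a, ?_⟩
      rw [Algebra.smul_def]
      exact ha
    have : (Ideal.span {π}).IsPrime := (Ideal.span_singleton_prime hπ.ne_zero).mpr hπ
    obtain ⟨q, hq, hqp, hqπ⟩ := Ideal.exists_ideal_over_prime_of_isIntegral (Ideal.span {π}) J hJπ
    obtain ⟨s, hs, a, ha⟩ := hT x hx q hqp (htOf_eq_one_of_comap_eq_span hπ q hqπ)
    exact hs (hq ((hJ s).mpr ⟨a, ha.symm⟩))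
  have : IsNoetherian P L := isNoetherian_of_fg_of_noetherian L hL
  have : IsNoetherian P ((Subalgebra.toSubmodule T).restrictScalars P) := isNoetherian_of_le hle
  have : Module.Finite P T :=
    inferInstanceAs (Module.Finite P ((Subalgebra.toSubmodule T).restrictScalars P))
  exact Module.Finite.of_restrictScalars_finite P A T

end CodimensionOne

section Overrings

variable {k K : Type*} [Field k] [Field K] [Algebra k K]

lemma isFractionRing_of_le {R S : Subalgebra k K} (h : R ≤ S) [IsFractionRing R K] :
    IsFractionRing S K := by
  refine IsFractionRing.of_field S K fun z => ?_
  obtain ⟨a, b, -, rfl⟩ := IsFractionRing.div_surjective (A := R) z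
  exact ⟨Subalgebra.inclusion h a, Subalgebra.inclusion h b, rfl⟩

/-- A fraction whose denominator lies outside the prime `n` belongs to `S_n`. -/
lemma inv_mem_locAt {S : Subalgebra k K} {n : Ideal S} {hn : n.IsPrime} {a s : S} (ha : a ∉ n) :
    (s : K) / a ∈ locAt S n hn := by
  have ha0 : (a : K) ≠ 0 := fun h => ha (by
    rw [show a = 0 from Subtype.ext h]
    exact n.zero_mem)
  exact ⟨s, a, ha, div_mul_cancel₀ _ ha0⟩

lemma isNoetherianRing_locAt (A : Subalgebra k K) [IsNoetherianRing A] (p : Ideal A)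
    (hp : p.IsPrime) : IsNoetherianRing (locAt A p hp) := by
  have hle : A ≤ locAt A p hp := fun x hx =>
    ⟨⟨x, hx⟩, 1, (Ideal.ne_top_iff_one p).mp hp.ne_top, by simp⟩
  let : Algebra A (locAt A p hp) := (Subalgebra.inclusion hle).toRingHom.toAlgebra
  have hmap : ∀ a : A, ((algebraMap A (locAt A p hp) a : locAt A p hp) : K) = a := fun _ => rfl
  have hne : ∀ s ∈ p.primeCompl, (s : K) ≠ 0 := fun s hs h => hs (by
    rw [show s = 0 from Subtype.ext h]
    exact p.zero_mem)
  have : IsLocalization p.primeCompl (locAt A p hp) :=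
    { map_units := fun s => by
        refine IsUnit.of_mul_eq_one
          ⟨((1 : A) : K) / (s : A), inv_mem_locAt s.2⟩ (Subtype.ext ?_)
        have := hne s s.2
        change ((s : A) : K) * (((1 : A) : K) / (s : A)) = 1
        simp [this]
      surj := fun z => by
        obtain ⟨a, s, hs, h⟩ := z.2
        exact ⟨(a, ⟨s, hs⟩), Subtype.ext h⟩
      exists_of_eq := fun {x y} h => ⟨1, by
        rw [show x = y from Subtype.ext (by rw [← hmap x, h, hmap])]⟩ }
  exact IsLocalization.isNoetherianRing p.primeCompl _ ‹_›

lemma locAt_eq_of_comap {S T : Subalgebra k K} (h : S ≤ T) (t : Ideal T) (ht : t.IsPrime)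
    (hT : T ≤ locAt S (t.comap (Subalgebra.inclusion h)) (ht.comap _)) :
    locAt S (t.comap (Subalgebra.inclusion h)) (ht.comap _) = locAt T t ht := by
  refine le_antisymm ?_ ?_
  · rintro x ⟨a, s, hs, hx⟩
    exact ⟨Subalgebra.inclusion h a, Subalgebra.inclusion h s, hs, hx⟩
  · rintro x ⟨z, y, hy, hx⟩
    obtain ⟨a, s, hs, has⟩ := hT y.2
    have ha : a ∉ t.comap (Subalgebra.inclusion h) := fun ha => by
      have : y * Subalgebra.inclusion h s ∈ t := by
        rw [show y * Subalgebra.inclusion h s = Subalgebra.inclusion h a from Subtype.ext has]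
        exact ha
      exact (ht.mem_or_mem this).elim hy hs
    have hy0 : (y : K) ≠ 0 := fun h0 => hy (by
      rw [show y = 0 from Subtype.ext h0]
      exact t.zero_mem)
    have hs0 : (s : K) ≠ 0 := fun h0 => hs (by
      rw [show s = 0 from Subtype.ext h0]
      exact Ideal.zero_mem _)
    have : x = z * ((s : K) / a) := by
      rw [← has, ← hx]
      field_simp
    rw [this]
    exact mul_mem (hT z.2) (inv_mem_locAt ha)

/-- Finiteness of `T` over `S` for a subalgebra `T` contained in all localizations of a finitely
generated domain `S` at height one primes. -/
lemma inclusion_finite_of_codimOne {S T : Subalgebra k K} (h : S ≤ T) (hS : S.FG)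
    [IsFractionRing S K]
    (hT : ∀ (q : Ideal S) (hq : q.IsPrime), htOf q = 1 → T ≤ locAt S q hq) :
    (Subalgebra.inclusion h).toRingHom.Finite := by
  have : Algebra.FiniteType k S := S.fg_iff_finiteType.mp hS
  obtain ⟨m, g, hg, hgfin⟩ := exists_finite_inj_algHom_of_fg k S
  let : Algebra (MvPolynomial (Fin m) k) S := g.toRingHom.toAlgebra
  have : FaithfulSMul (MvPolynomial (Fin m) k) S :=
    (faithfulSMul_iff_algebraMap_injective _ _).mpr hg
  have : Module.Finite (MvPolynomial (Fin m) k) S := hgfin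
  let T' : Subalgebra S K := { T.toSubsemiring with algebraMap_mem' := fun s => h s.2 }
  have : Module.Finite S T' := by
    refine finite_of_le_codimOne (MvPolynomial (Fin m) k) T' fun x hx q hq hq1 => ?_
    obtain ⟨a, s, hs, hxs⟩ := hT q hq hq1 hx
    exact ⟨s, hs, a, (mul_comm _ _).trans hxs⟩
  exact this

end Overrings

/-- If `R` is noetherian in codimension 1 with witnessing depiction `S`, then
`T := ⋂_{n ∈ U_{S/R}} S_n` is a depiction of `R`. -/
theorem depT_isDepiction (k K : Type*) [Field k] [IsAlgClosed k] [Field K] [Algebra k K]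
    (R : Subalgebra k K) (hfrac : IsFractionRing ↥R K)
    (S : Subalgebra k K) (hS : IsDepiction R S) (hw : Witnessing R S hS.le) :
    IsDepiction R (depT R S hS.le) := by
  have hST := le_depT R S hS.le
  have := isFractionRing_of_le hS.le
  have hfin : (Subalgebra.inclusion hST).toRingHom.Finite := by
    refine inclusion_finite_of_codimOne hST hS.fg fun q hq hq1 => ?_
    obtain ⟨-, n, hn, hqn⟩ := hw q hq hq1
    refine (sInf_le ⟨n, hn.1, hn, rfl⟩ : depT R S hS.le ≤ _).trans ?_
    rintro x ⟨a, s, hs, hx⟩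
    exact ⟨a, s, fun h => hs (hqn h), hx⟩
  have hint : (Subalgebra.inclusion hST).toRingHom.IsIntegral := hfin.to_isIntegral
  have hfg : (depT R S hS.le).FG := by
    rw [Subalgebra.fg_iff_finiteType]
    have h1 : (algebraMap k S).FiniteType :=
      (RingHom.finiteType_algebraMap).mpr (S.fg_iff_finiteType.mp hS.fg)
    exact RingHom.finiteType_algebraMap.mp (hfin.finiteType.comp h1)
  have : IsNoetherianRing (depT R S hS.le) :=
    have := (depT R S hS.le).fg_iff_finiteType.mp hfg
    Algebra.FiniteType.isNoetherianRing k _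
  have lying : ∀ q : Ideal S, q.IsPrime → ∃ t : Ideal (depT R S hS.le), t.IsPrime ∧
      t.comap (Subalgebra.inclusion hST) = q := by
    intro q hq
    let := (Subalgebra.inclusion hST).toRingHom.toAlgebra
    have : Algebra.IsIntegral S (depT R S hS.le) := ⟨hint⟩
    refine Ideal.exists_ideal_over_prime_of_isIntegral_of_isDomain q ?_
    exact ((RingHom.injective_iff_ker_eq_bot _).mp (Subalgebra.inclusion_injective hST)).trans_le
      bot_le
  have noeth : ∀ (t : Ideal (depT R S hS.le)) (ht : t.IsMaximal),
      memU R S hS.le (t.comap (Subalgebra.inclusion hST)) →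
      memU R (depT R S hS.le) (hS.le.trans hST) t := by
    rintro t ht hU
    obtain ⟨hn, hRS⟩ := id hU
    refine ⟨ht, Eq.trans hRS (locAt_eq_of_comap hST t ht.isPrime ?_)⟩
    exact sInf_le ⟨_, hn, hU, rfl⟩
  refine ⟨hS.le.trans hST, hfg, fun p hp => ?_, fun t ht => ⟨fun hU => ?_, fun hN => ?_⟩, ?_⟩
  · obtain ⟨q, hq, rfl⟩ := hS.specSurj p hp
    obtain ⟨t, ht, rfl⟩ := lying q hq
    exact ⟨t, ht, rfl⟩
  · obtain ⟨_, hU⟩ := hU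
    rw [hU]
    exact isNoetherianRing_locAt _ t ht.isPrime
  · have hn : (t.comap (Subalgebra.inclusion hST)).IsMaximal :=
      Ideal.isMaximal_comap_of_isIntegral_of_isMaximal' _ hint t
    exact noeth t ht ((hS.memU_iff _ hn).mpr hN)
  · obtain ⟨n, hn⟩ := hS.nonempty
    obtain ⟨t, ht, rfl⟩ := lying n hn.1.isPrime
    exact ⟨t, noeth t (Ideal.isMaximal_of_isIntegral_of_isMaximal_comap' _ hint t hn.1) hn⟩
end

section
/- If S is a saturated depiction of R, then for each prime q of S that is minimal over the ideal (q ∩ R)S, the geometric dimension of q ∩ R equals the Krull dimension of S/q, i.e. gdim(q ∩ R) = dim S/q. -/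
theorem exists_ltSeries_last_liesOver_of_isIntegral {R S : Type*} [CommRing R] [CommRing S]
    [Algebra R S] [Algebra.IsIntegral R S] [FaithfulSMul R S] (l : LTSeries (PrimeSpectrum R)) :
    ∃ L : LTSeries (PrimeSpectrum S), L.length = l.length ∧
      L.last.comap (algebraMap R S) = l.last := by
  induction l using RelSeries.inductionOn' with
  | singleton p =>
    obtain ⟨Q, -, hQ, hQp⟩ := Ideal.exists_ideal_over_prime_of_isIntegral p.asIdeal (⊥ : Ideal S)
      (by
        rw [← RingHom.ker_eq_comap_bot,
          (RingHom.injective_iff_ker_eq_bot _).mp (FaithfulSMul.algebraMap_injective R S)]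
        exact bot_le)
    exact ⟨RelSeries.singleton _ ⟨Q, hQ⟩, rfl, PrimeSpectrum.ext (by simpa using hQp)⟩
  | snoc l p lt ih =>
    obtain ⟨L, hlen, hlast⟩ := ih
    have hlt : l.last < p := lt
    obtain ⟨Q, hle, hQ, hQp⟩ := Ideal.exists_ideal_over_prime_of_isIntegral p.asIdeal
      L.last.asIdeal (by
        have := congrArg PrimeSpectrum.asIdeal hlast
        rw [PrimeSpectrum.comap_asIdeal] at this
        rw [this]
        exact hlt.le)
    have hQp' : PrimeSpectrum.comap (algebraMap R S) ⟨Q, hQ⟩ = p :=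
      PrimeSpectrum.ext (by simpa using hQp)
    have hlt' : L.last < ⟨Q, hQ⟩ := by
      refine lt_of_le_of_ne hle fun h ↦ hlt.ne ?_
      rw [← hlast, h, hQp']
    exact ⟨L.snoc ⟨Q, hQ⟩ hlt', by simp [hlen], by simpa using hQp'⟩

theorem ringKrullDim_eq_of_isIntegral (R S : Type*) [CommRing R] [CommRing S]
    [Algebra R S] [Algebra.IsIntegral R S] [FaithfulSMul R S] :
    ringKrullDim R = ringKrullDim S := by
  refine le_antisymm (iSup_le fun l ↦ ?_) ?_
  · obtain ⟨L, hL, -⟩ := exists_ltSeries_last_liesOver_of_isIntegral (S := S) l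
    rw [← hL]
    exact le_iSup (fun p : LTSeries (PrimeSpectrum S) ↦ (p.length : WithBot ℕ∞)) L
  · refine Order.krullDim_le_of_strictMono (PrimeSpectrum.comap (algebraMap R S)) fun P Q h ↦ ?_
    exact Ideal.IsIntegral.comap_lt_comap (R := R) h

namespace MvPolynomial

theorem height_of_isMaximal {k : Type*} [Field k] {n : ℕ} (m : Ideal (MvPolynomial (Fin n) k))
    [m.IsMaximal] : m.height = n := by
  induction n with
  | zero =>
    refine le_antisymm ?_ (by simp)
    have h := Ideal.height_le_ringKrullDim_of_isPrime (I := m)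
    simpa using h
  | succ n ih =>
    let e := (finSuccEquiv k n).toRingEquiv
    rw [← e.symm.height_comap m]
    have hM : (m.comap e.symm).IsMaximal := Ideal.comap_isMaximal_of_equiv e.symm
    generalize m.comap e.symm = M at hM ⊢
    have : (M.under (MvPolynomial (Fin n) k)).IsMaximal :=
      Polynomial.isMaximal_comap_C_of_isJacobsonRing M
    rw [Polynomial.height_eq_height_add_one (M.under (MvPolynomial (Fin n) k)) M, ih]
    simp

theorem ringKrullDim_fin (k : Type*) [Field k] (n : ℕ) :
    ringKrullDim (MvPolynomial (Fin n) k) = n := by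
  simp

end MvPolynomial

theorem Ideal.height_add_one_le_height_comap_mk {R : Type*} [CommRing R] [IsDomain R]
    [IsNoetherianRing R] {I : Ideal R} (hI : I ≠ ⊥) (q : Ideal (R ⧸ I)) [q.IsPrime] :
    q.height + 1 ≤ (q.comap (Ideal.Quotient.mk I)).height := by
  obtain ⟨l, hl, hlen⟩ := q.exists_ltSeries_length_eq_height
  have hmono : StrictMono (PrimeSpectrum.comap (Ideal.Quotient.mk I)) := fun P Q h ↦
    (Ideal.orderEmbeddingOfSurjective _ Ideal.Quotient.mk_surjective).strictMono h
  let l' : LTSeries (PrimeSpectrum R) := l.map _ hmono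
  have h0 : (⊥ : PrimeSpectrum R) < l'.head := by
    refine lt_of_le_of_ne bot_le fun h ↦ hI ?_
    have h1 : I ≤ l'.head.asIdeal := by
      intro x hx
      rw [LTSeries.head_map]
      simp [Ideal.Quotient.eq_zero_iff_mem.mpr hx]
    rw [← h] at h1
    exact le_bot_iff.mp h1
  have := Order.length_le_height (p := l'.cons ⊥ h0)
    (x := ⟨q.comap (Ideal.Quotient.mk I), inferInstance⟩)
    (by rw [RelSeries.last_cons, LTSeries.last_map, hl]; rfl)
  rw [← PrimeSpectrum.height_eq_orderHeight] at this
  rw [← hlen, show l.length = l'.length from rfl]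
  simpa only [RelSeries.cons_length, Nat.cast_add, Nat.cast_one] using this

theorem ringKrullDim_le_height_add_of_isIntegral {B A : Type*} [CommRing B] [CommRing A]
    [IsDomain A] [IsNoetherianRing A] [IsNoetherianRing B] [IsIntegrallyClosed B]
    [Algebra B A] [Algebra.IsIntegral B A] [FaithfulSMul B A] (q : Ideal A) [q.IsPrime]
    (h : ringKrullDim B ≤ (q.under B).height + ringKrullDim (B ⧸ q.under B)) :
    ringKrullDim A ≤ q.height + ringKrullDim (A ⧸ q) := by
  rw [← ringKrullDim_eq_of_isIntegral B A, ← ringKrullDim_eq_of_isIntegral (B ⧸ q.under B) (A ⧸ q)]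
  refine h.trans (add_le_add_left (WithBot.coe_le_coe.mpr ?_) _)
  rw [Ideal.height_eq_height_add_of_liesOver_of_hasGoingDown (q.under B) q]
  exact le_self_add

namespace MvPolynomial

theorem ringKrullDim_le_height_add {k : Type*} [Field k] {n : ℕ}
    (p : Ideal (MvPolynomial (Fin n) k)) [hp : p.IsPrime] :
    ringKrullDim (MvPolynomial (Fin n) k) ≤ p.height +
      ringKrullDim (MvPolynomial (Fin n) k ⧸ p) := by
  induction n with
  | zero =>
    rw [ringKrullDim_fin]
    have : Nontrivial (MvPolynomial (Fin 0) k ⧸ p) := inferInstance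
    exact add_nonneg (by simp) ringKrullDim_nonneg_of_nontrivial
  | succ n ih =>
    by_cases hp0 : p = ⊥
    · subst hp0
      rw [Ideal.height_bot,
        ringKrullDim_eq_of_ringEquiv (RingEquiv.quotientBot (MvPolynomial (Fin (n + 1)) k))]
      simp
    obtain ⟨f, hfp, hf⟩ := hp.exists_mem_prime_of_ne_bot hp0
    let A := MvPolynomial (Fin (n + 1)) k ⧸ Ideal.span {f}
    have hfI : (Ideal.span {f}).IsPrime := (Ideal.span_singleton_prime hf.ne_zero).mpr hf
    obtain ⟨m, hm, hpm⟩ := Ideal.exists_le_maximal p hp.ne_top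
    have hA : (n : WithBot ℕ∞) ≤ ringKrullDim A := by
      have := Ideal.height_le_ringKrullDim_quotient_add_one (hpm hfp)
      rw [height_of_isMaximal m] at this
      change _ ≤ ringKrullDim A + 1 at this
      push_cast at this
      exact ENat.WithBot.add_le_add_one_right_iff.mp this
    have hA' : ringKrullDim A ≤ n := by
      have := ringKrullDim_quotient_succ_le_of_nonZeroDivisor
        (mem_nonZeroDivisors_of_ne_zero hf.ne_zero)
      rw [ringKrullDim_fin] at this
      change ringKrullDim A + 1 ≤ _ at this
      push_cast at this
      exact ENat.WithBot.add_le_add_one_right_iff.mp this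
    obtain ⟨s, g, hg, hgi⟩ := exists_integral_inj_algHom_of_fg k A
    algebraize [g.toRingHom]
    have : FaithfulSMul (MvPolynomial (Fin s) k) A :=
      (faithfulSMul_iff_algebraMap_injective _ _).mpr hg
    have : Algebra.IsIntegral (MvPolynomial (Fin s) k) A := ⟨hgi⟩
    have hs : s = n := by
      have := ringKrullDim_eq_of_isIntegral (MvPolynomial (Fin s) k) A
      rw [ringKrullDim_fin, le_antisymm hA' hA] at this
      exact_mod_cast this
    subst hs
    let q : Ideal A := p.map (Ideal.Quotient.mk (Ideal.span {f}))
    have hle : Ideal.span {f} ≤ p := by simpa [Ideal.span_le] using hfp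
    have hqp : q.comap (Ideal.Quotient.mk (Ideal.span {f})) = p := by
      rw [Ideal.comap_map_of_surjective _ Ideal.Quotient.mk_surjective,
        ← RingHom.ker_eq_comap_bot, Ideal.mk_ker, sup_eq_left.mpr hle]
    have hq : q.IsPrime :=
      Ideal.map_isPrime_of_surjective Ideal.Quotient.mk_surjective (by rwa [Ideal.mk_ker])
    have key := ringKrullDim_le_height_add_of_isIntegral q (ih _)
    have e : ringKrullDim (A ⧸ q) = ringKrullDim (MvPolynomial (Fin (s + 1)) k ⧸ p) :=
      ringKrullDim_eq_of_ringEquiv (DoubleQuot.quotQuotEquivQuotOfLE hle)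
    have hht : q.height + 1 ≤ p.height := by
      have := Ideal.height_add_one_le_height_comap_mk
        (by simpa using hf.ne_zero : Ideal.span {f} ≠ ⊥) q
      rwa [hqp] at this
    rw [le_antisymm hA' hA, e] at key
    rw [ringKrullDim_fin]
    calc ((s + 1 : ℕ) : WithBot ℕ∞) = s + 1 := by push_cast; rfl
      _ ≤ (q.height + ringKrullDim (MvPolynomial (Fin (s + 1)) k ⧸ p)) + 1 := by gcongr
      _ = ((q.height + 1 : ℕ∞) : WithBot ℕ∞) + ringKrullDim (MvPolynomial (Fin (s + 1)) k ⧸ p) := by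
        push_cast; ring
      _ ≤ _ := add_le_add_left (WithBot.coe_le_coe.mpr hht) _

end MvPolynomial

theorem Ideal.height_add_ringKrullDim_quotient_le {A : Type*} [CommRing A] (q : Ideal A)
    [hq : q.IsPrime] : q.height + ringKrullDim (A ⧸ q) ≤ ringKrullDim A := by
  let x : PrimeSpectrum A := ⟨q, hq⟩
  have hx : ringKrullDim (A ⧸ q) = Order.coheight x := by
    rw [Order.coheight_eq_krullDim_Ici, ringKrullDim_quotient]
    rfl
  have : Nonempty (PrimeSpectrum A) := ⟨x⟩
  rw [hx, ringKrullDim, Order.krullDim_eq_iSup_height_add_coheight_of_nonempty,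
    ← WithBot.coe_add, WithBot.coe_le_coe, show q.height = Order.height x from
      PrimeSpectrum.height_eq_orderHeight x]
  exact le_iSup (fun y : PrimeSpectrum A ↦ Order.height y + Order.coheight y) x

theorem Ideal.height_add_ringKrullDim_quotient_eq (k : Type*) {A : Type*} [Field k] [CommRing A]
    [IsDomain A] [Algebra k A] [Algebra.FiniteType k A] (q : Ideal A) [q.IsPrime] :
    q.height + ringKrullDim (A ⧸ q) = ringKrullDim A := by
  refine le_antisymm q.height_add_ringKrullDim_quotient_le ?_
  obtain ⟨s, g, hg, hgi⟩ := exists_integral_inj_algHom_of_fg k A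
  algebraize [g.toRingHom]
  have : FaithfulSMul (MvPolynomial (Fin s) k) A :=
    (faithfulSMul_iff_algebraMap_injective _ _).mpr hg
  have : Algebra.IsIntegral (MvPolynomial (Fin s) k) A := ⟨hgi⟩
  have : IsNoetherianRing A := Algebra.FiniteType.isNoetherianRing k A
  exact ringKrullDim_le_height_add_of_isIntegral (B := MvPolynomial (Fin s) k) q
    (MvPolynomial.ringKrullDim_le_height_add _)

theorem exists_ringKrullDim_eq_and_trdeg_eq (k : Type*) (A : Type*) [Field k] [CommRing A]
    [IsDomain A] [Algebra k A] [Algebra.FiniteType k A] :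
    ∃ s : ℕ, ringKrullDim A = s ∧ Algebra.trdeg k A = s := by
  obtain ⟨s, g, hg, hgi⟩ := exists_integral_inj_algHom_of_fg k A
  algebraize [g.toRingHom]
  have : FaithfulSMul (MvPolynomial (Fin s) k) A :=
    (faithfulSMul_iff_algebraMap_injective _ _).mpr hg
  have : Algebra.IsIntegral (MvPolynomial (Fin s) k) A := ⟨hgi⟩
  have : IsScalarTower k (MvPolynomial (Fin s) k) A :=
    .of_algebraMap_eq fun x ↦ (g.commutes x).symm
  refine ⟨s, ?_, ?_⟩
  · rw [← ringKrullDim_eq_of_isIntegral (MvPolynomial (Fin s) k) A,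
      MvPolynomial.ringKrullDim_fin]
  · have h := lift_trdeg_add_eq k (MvPolynomial (Fin s) k) A
    rw [trdeg_eq_zero (R := MvPolynomial (Fin s) k) (A := A),
      MvPolynomial.trdeg_of_isDomain] at h
    simpa using h.symm

theorem Ideal.height_eq_ringKrullDim_of_isMaximal (k : Type*) {A : Type*} [Field k] [CommRing A]
    [IsDomain A] [Algebra k A] [Algebra.FiniteType k A] (m : Ideal A) [hm : m.IsMaximal] :
    (m.height : WithBot ℕ∞) = ringKrullDim A := by
  rw [← m.height_add_ringKrullDim_quotient_eq k,
    ringKrullDim_eq_zero_of_isField ((Ideal.Quotient.maximal_ideal_iff_isField_quotient m).mp hm),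
    add_zero]

theorem ringKrullDim_le_of_injective_of_finiteType (k : Type*) {A : Type*} [Field k] [CommRing A]
    [IsDomain A] [Algebra k A] [Algebra.FiniteType k A] {R : Type*}
    [CommRing R] [Algebra k R] (f : R →ₐ[k] A) (hf : Function.Injective f) : ringKrullDim R ≤ ringKrullDim A := by
  have : IsDomain R := hf.isDomain f.toRingHom
  refine iSup_le fun l ↦ ?_
  have hx (i : Fin l.length) : ∃ x, x ∈ (l i.succ).asIdeal ∧ x ∉ (l i.castSucc).asIdeal :=
    SetLike.exists_of_lt (l.step i)
  choose x hx hx' using hx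
  let B := Algebra.adjoin k (Set.range x)
  have : Algebra.FiniteType k B :=
    (Subalgebra.fg_iff_finiteType B).mp (Subalgebra.fg_def.mpr ⟨_, Set.finite_range x, rfl⟩)
  have hB (i) : x i ∈ B := Algebra.subset_adjoin ⟨i, rfl⟩
  let L : LTSeries (PrimeSpectrum B) :=
    { length := l.length
      toFun := fun i ↦ (l i).comap B.val.toRingHom
      step := fun i ↦ SetLike.lt_iff_le_and_exists.mpr
        ⟨Ideal.comap_mono (l.step i).le, ⟨x i, hB i⟩, hx i, hx' i⟩ }
  obtain ⟨s, hs, hs'⟩ := exists_ringKrullDim_eq_and_trdeg_eq k B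
  obtain ⟨t, ht, ht'⟩ := exists_ringKrullDim_eq_and_trdeg_eq k A
  have hst := lift_trdeg_le_of_injective (f.comp B.val)
    (hf.comp Subtype.val_injective)
  rw [hs', ht', Cardinal.lift_natCast, Cardinal.lift_natCast, Nat.cast_le] at hst
  calc (l.length : WithBot ℕ∞) ≤ ringKrullDim B :=
        Order.LTSeries.length_le_krullDim L
    _ ≤ ringKrullDim A := by rw [hs, ht]; exact_mod_cast hst

theorem htOf_eq_height {A : Type*} [CommRing A] (q : Ideal A) [hq : q.IsPrime] :
    htOf q = q.height := by
  rw [show q.height = Order.height (⟨q, hq⟩ : PrimeSpectrum A) from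
    PrimeSpectrum.height_eq_orderHeight ⟨q, hq⟩, Order.height_eq_krullDim_Iic]
  rfl

section Depictions

variable {k K : Type*} [Field k] [Field K] [Algebra k K]

theorem le_locAt (A : Subalgebra k K) (p : Ideal A) (hp : p.IsPrime) : A ≤ locAt A p hp :=
  fun x hx ↦ ⟨⟨x, hx⟩, 1, (Ideal.ne_top_iff_one p).mp hp.ne_top, by simp⟩

theorem ringKrullDim_locAt (A : Subalgebra k K) (p : Ideal A) (hp : p.IsPrime) :
    ringKrullDim (locAt A p hp) = p.height := by
  let _ : Algebra A (locAt A p hp) := (Subalgebra.inclusion (le_locAt A p hp)).toRingHom.toAlgebra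
  have hmap (a : A) : ((algebraMap A (locAt A p hp) a : locAt A p hp) : K) = a := rfl
  have hne {s : A} (hs : s ∉ p) : (s : K) ≠ 0 := fun h ↦
    hs (by rw [show s = 0 from Subtype.ext h]; exact p.zero_mem)
  have : IsLocalization.AtPrime (locAt A p hp) p :=
    { map_units := fun s ↦ by
        refine IsUnit.of_mul_eq_one ⟨(s : K)⁻¹, 1, s, s.2, ?_⟩ (Subtype.ext ?_)
        · simp [inv_mul_cancel₀ (hne s.2)]
        · simp [hmap, mul_inv_cancel₀ (hne s.2)]
      surj := by
        rintro ⟨x, a, s, hs, h⟩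
        exact ⟨(a, ⟨s, hs⟩), Subtype.ext h⟩
      exists_of_eq := fun {a b} h ↦
        ⟨1, by
          rw [show a = b from Subtype.ext (congrArg (Subtype.val (p := (· ∈ locAt A p hp))) h)]⟩ }
  exact IsLocalization.AtPrime.ringKrullDim_eq_height p _

theorem IsDepiction.ringKrullDim_eq {R S : Subalgebra k K} (hS : IsDepiction R S) :
    ringKrullDim R = ringKrullDim S := by
  have : Algebra.FiniteType k S := S.fg_iff_finiteType.mp hS.fg
  refine le_antisymm (ringKrullDim_le_of_injective_of_finiteType k (Subalgebra.inclusion hS.le)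
    (Subalgebra.inclusion_injective hS.le)) ?_
  obtain ⟨n, hn, heq⟩ := hS.nonempty
  have := hn.isPrime
  have := hn.isPrime.comap (Subalgebra.inclusion hS.le)
  rw [← n.height_eq_ringKrullDim_of_isMaximal k, ← ringKrullDim_locAt S n hn.isPrime, ← heq,
    ringKrullDim_locAt]
  exact Ideal.height_le_ringKrullDim_of_isPrime

end Depictions

/-- If `S` is a saturated depiction of `R` (with `R` of finite Krull dimension), then for
each prime `q` of `S` minimal over `(q ∩ R)S`, `gdim (q ∩ R) = dim S/q`. -/
theorem gdim_eq_dim_quotient_of_saturated (k K : Type*) [Field k] [IsAlgClosed k] [Field K] [Algebra k K]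
    (R : Subalgebra k K) (hfrac : IsFractionRing ↥R K)
    (hdim : ringKrullDim ↥R ≠ ⊤)
    (S : Subalgebra k K) (hS : IsDepiction R S) (hsat : IsSaturated R S hS.le) :
    ∀ q : Ideal S,
      q ∈ (Ideal.map (Subalgebra.inclusion hS.le)
            (q.comap (Subalgebra.inclusion hS.le))).minimalPrimes →
      gdim R (q.comap (Subalgebra.inclusion hS.le)) = ringKrullDim (↥S ⧸ q) := by
  intro q hq
  have hqp : q.IsPrime := hq.1.1
  have : Algebra.FiniteType k S := S.fg_iff_finiteType.mp hS.fg
  obtain ⟨s, hs, -⟩ := exists_ringKrullDim_eq_and_trdeg_eq k S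
  have hadd := q.height_add_ringKrullDim_quotient_eq k
  rw [gdim, hsat q hq, htOf_eq_height, hS.ringKrullDim_eq, ← hadd]
  have hne : q.height ≠ ⊤ := by
    have := Ideal.height_le_ringKrullDim_of_isPrime (I := q)
    rw [hs] at this
    exact ((WithBot.coe_le_coe.mp this).trans_lt (ENat.natCast_lt_top s)).ne
  have : Nontrivial (S ⧸ q) := Ideal.Quotient.nontrivial_iff.mpr hqp.ne_top
  have hnonneg : 0 ≤ ringKrullDim (S ⧸ q) := ringKrullDim_nonneg_of_nontrivial
  obtain ⟨d, hd⟩ := WithBot.ne_bot_iff_exists.mp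
    (ne_of_gt ((WithBot.bot_lt_coe (0 : ℕ∞)).trans_le hnonneg))
  rw [← hd]
  exact congrArg WithBot.some ((ENat.addLECancellable_of_ne_top hne).add_tsub_cancel_left)
end
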